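/- Let N ≥ 2, σ > 0, μ ∈ ℝ, and let Y₁,…,Y_N be independent and identically distributed N(μ,σ²) random variables with sample mean Ȳ = (1/N)Σ_k Y_k. Define the discrete bridge W_i = Σ_{k=1}^i (Y_k − Ȳ) for i = 1,…,N−1. Then for every u > 0, ℙ( max_{1≤i≤N−1} |W_i| ≤ σ√N·u ) ≥ 1 − 2·exp(−2u²). -/

import Mathlib

open MeasureTheory ProbabilityTheory

lemma gauss_lintegral_exp {Ω : Type*} [MeasurableSpace Ω] {P : Measure Ω} {X : Ω → ℝ}
    (hX : HasGaussianLaw X P) (h0 : ∫ ω, X ω ∂P = 0) (t c : ℝ) :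
    ∫⁻ ω, ENNReal.ofReal (Real.exp (t * X ω + c)) ∂P
      = ENNReal.ofReal (Real.exp (cov[X, X; P] * t ^ 2 / 2 + c)) := by
  have hm := hX.map_eq_gaussianReal
  have hi : Integrable (fun ω => Real.exp (t * X ω)) P := by
    have := integrable_exp_mul_gaussianReal (μ := P[X]) (v := (Var[X; P]).toNNReal) t
    rw [← hm] at this
    exact (integrable_map_measure (by fun_prop) hX.aemeasurable).1 this
  have hg := mgf_gaussianReal hm t
  have hv : cov[X, X; P] = Var[X; P] := covariance_self hX.aemeasurable
  rw [← ofReal_integral_eq_lintegral_ofReal]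
  · simp_rw [Real.exp_add]
    rw [integral_mul_const]
    have : ∫ ω, Real.exp (t * X ω) ∂P = mgf X P t := rfl
    rw [this, hg, h0, hv, Real.coe_toNNReal _ (variance_nonneg _ _), zero_mul, zero_add]
  · simp_rw [Real.exp_add]; exact hi.mul_const _
  · exact Filter.Eventually.of_forall fun ω => (Real.exp_pos _).le

lemma bridge_one_sided {Ω : Type*} [MeasurableSpace Ω] {P : Measure Ω}
    (N : ℕ) (hN : 2 ≤ N) (σ : ℝ) (hσ : 0 < σ) (W : ℕ → Ω → ℝ)
    (hWm : ∀ i, Measurable (W i))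
    (hG : HasGaussianLaw (fun ω (i : Fin N) => W i ω) P)
    (h0 : ∀ i, i < N → ∫ ω, W i ω ∂P = 0)
    (hc : ∀ i j, i ≤ j → j < N → cov[W i, W j; P] = σ ^ 2 * i * (N - j) / N)
    (a : ℝ) (ha : 0 < a) :
    P {ω | ∃ i, i < N ∧ a < W i ω} ≤ ENNReal.ofReal (Real.exp (- 2 * a ^ 2 / (σ ^ 2 * N))) := by
  have hP := hG.isProbabilityMeasure
  have hN0 : (0:ℝ) < N := by positivity
  have hGe : ∀ i, i < N → HasGaussianLaw (W i) P := fun i hi =>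
    hG.eval (X := fun (i : Fin N) => W i) ⟨i, hi⟩
  set θ : ℝ := 2 * a / σ ^ 2 with hθ
  set A : ℕ → Set Ω := fun i => {ω | a < W i ω ∧ ∀ j < i, W j ω ≤ a} with hA
  have hAm : ∀ i, MeasurableSet (A i) := by
    intro i
    simp only [hA, Set.ofPred_and, Set.ofPred_forall]
    refine (measurableSet_lt measurable_const (hWm i)).inter ?_
    exact MeasurableSet.iInter fun j => MeasurableSet.iInter fun _ =>
      measurableSet_le (hWm j) measurable_const
  have hAd : ∀ i j, i < j → Disjoint (A i) (A j) := by
    intro i j hij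
    rw [Set.disjoint_left]
    intro ω h1 h2
    exact absurd h1.1 (not_lt.2 (h2.2 i hij))
  set G : Ω → ENNReal := fun ω =>
    ENNReal.ofReal (Real.exp (θ * W (N - 1) ω + -(2 * a ^ 2 / σ ^ 2))) with hGdef
  have key : ∀ i ∈ Finset.range N, P (A i) ≤ ∫⁻ ω in A i, G ω ∂P := by
    intro i hi
    have hi : i < N := Finset.mem_range.1 hi
    have hNi : (0:ℝ) < (N:ℝ) - i := by
      have : (i:ℝ) < N := by exact_mod_cast hi
      linarith
    set Z : Ω → ℝ := fun ω => W (N - 1) ω - ((N:ℝ) - i)⁻¹ * W i ω with hZ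
    have hGZ : HasGaussianLaw Z P :=
      hG.map_fun (ContinuousLinearMap.proj (R := ℝ) (φ := fun _ : Fin N => ℝ) ⟨N - 1, by omega⟩
        - ((N:ℝ) - i)⁻¹ • ContinuousLinearMap.proj (R := ℝ) (φ := fun _ : Fin N => ℝ) ⟨i, hi⟩)
    have hM : ∀ j, j < N → MemLp (W j) 2 P := fun j hj => (hGe j hj).memLp_two
    have hM' : MemLp (fun ω => ((N:ℝ) - i)⁻¹ * W i ω) 2 P := (hM i hi).const_mul _
    have hcast : ((N - 1 : ℕ) : ℝ) = (N:ℝ) - 1 := by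
      rw [Nat.cast_sub (by omega)]; simp
    have hcZ : ∀ j ≤ i, cov[W j, Z; P] = 0 := by
      intro j hj
      rw [hZ, covariance_fun_sub_right (hM j (by omega)) (hM _ (by omega)) hM',
        covariance_const_mul_right, hc j (N-1) (by omega) (by omega), hc j i hj hi, hcast]
      field_simp
      ring
    have hvZ : cov[Z, Z; P] = σ ^ 2 * (1 - 1 / ((N:ℝ) - i)) := by
      have e1 : cov[Z, Z; P] = cov[W (N-1), Z; P] - ((N:ℝ) - i)⁻¹ * cov[W i, Z; P] := by
        conv_lhs => rw [hZ]
        rw [covariance_fun_sub_left (hM _ (by omega)) hM' hGZ.memLp_two,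
          covariance_const_mul_left]
      rw [e1, hcZ i le_rfl, hZ, covariance_fun_sub_right (hM _ (by omega)) (hM _ (by omega)) hM',
        covariance_const_mul_right, hc (N-1) (N-1) le_rfl (by omega), covariance_comm,
        hc i (N-1) (by omega) (by omega), hcast]
      field_simp
      ring
    have h0Z : ∫ ω, Z ω ∂P = 0 := by
      rw [hZ, integral_sub (hGe _ (by omega)).integrable ((hGe i hi).integrable.const_mul _),
        integral_const_mul, h0 _ (by omega), h0 i hi]
      simp
    -- independence
    have hind : IndepFun (fun ω (j : Fin (i+1)) => W j ω) (fun ω (_ : Unit) => Z ω) P := by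
      refine HasGaussianLaw.indepFun_of_covariance_eval (X := fun (j : Fin (i+1)) => W j)
        (Y := fun _ : Unit => Z) ?_ ?_
      · exact hG.map_fun (ContinuousLinearMap.prod
          (ContinuousLinearMap.pi fun j : Fin (i+1) =>
            ContinuousLinearMap.proj (R := ℝ) (φ := fun _ : Fin N => ℝ) ⟨j, by omega⟩)
          (ContinuousLinearMap.pi fun _ : Unit =>
           (ContinuousLinearMap.proj (R := ℝ) (φ := fun _ : Fin N => ℝ) ⟨N - 1, by omega⟩
        - ((N:ℝ) - i)⁻¹ • ContinuousLinearMap.proj (R := ℝ) (φ := fun _ : Fin N => ℝ) ⟨i, hi⟩)))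
      · intro j _
        exact hcZ j (by omega)
    set B : Set (Fin (i+1) → ℝ) := {x | a < x (Fin.last i) ∧ ∀ j : Fin (i+1), (j:ℕ) < i → x j ≤ a}
      with hB
    have hBm : MeasurableSet B := by
      simp only [hB, Set.ofPred_and, Set.ofPred_forall]
      refine (measurableSet_lt measurable_const (measurable_pi_apply _)).inter ?_
      exact MeasurableSet.iInter fun j => MeasurableSet.iInter fun _ =>
        measurableSet_le (measurable_pi_apply _) measurable_const
    set f : (Fin (i+1) → ℝ) → ENNReal := B.indicator fun x =>
      ENNReal.ofReal (Real.exp (θ * (((N:ℝ) - i)⁻¹ * x (Fin.last i))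
        + -(2 * a ^ 2 / (σ ^ 2 * ((N:ℝ) - i))))) with hf
    set g : (Unit → ℝ) → ENNReal := fun z =>
      ENNReal.ofReal (Real.exp (θ * z () + -(2 * a ^ 2 / σ ^ 2 * (1 - 1 / ((N:ℝ) - i))))) with hg
    have hfm : Measurable f := by
      refine Measurable.indicator ?_ hBm
      fun_prop
    have hgm : Measurable g := by fun_prop
    have hmem : ∀ ω, (fun (j : Fin (i+1)) => W j ω) ∈ B ↔ ω ∈ A i := by
      intro ω
      simp only [hB, hA, Set.mem_ofPred_eq, Fin.val_last]
      refine and_congr_right fun _ => ⟨fun h j hj => h ⟨j, by omega⟩ hj, fun h j hj => h j hj⟩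
    have hfg : ∀ ω, f (fun j => W j ω) * g (fun _ => Z ω) = (A i).indicator G ω := by
      intro ω
      by_cases hω : ω ∈ A i
      · rw [hf, Set.indicator_of_mem ((hmem ω).2 hω), Set.indicator_of_mem hω, hg, hGdef,
          ← ENNReal.ofReal_mul (Real.exp_pos _).le, ← Real.exp_add]
        congr 2
        simp only [hZ, Fin.val_last]
        field_simp
        ring
      · rw [hf, Set.indicator_of_notMem (fun h => hω ((hmem ω).1 h)), Set.indicator_of_notMem hω,
          zero_mul]
    have hg1 : ∫⁻ ω, g (fun _ => Z ω) ∂P = 1 := by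
      rw [hg]
      simp only
      rw [gauss_lintegral_exp hGZ h0Z, hvZ]
      have : σ ^ 2 * (1 - 1 / ((N:ℝ) - i)) * θ ^ 2 / 2
          + -(2 * a ^ 2 / σ ^ 2 * (1 - 1 / ((N:ℝ) - i))) = 0 := by
        rw [hθ]; field_simp; ring
      rw [this]; simp
    have hmul := lintegral_mul_eq_lintegral_mul_lintegral_of_indepFun
      (f := fun ω => f (fun j => W j ω)) (g := fun ω => g (fun _ => Z ω)) (μ := P)
      (hfm.comp (measurable_pi_lambda _ fun j => hWm j))
      (hgm.comp (measurable_pi_lambda _ fun _ => ((hWm _).sub ((hWm _).const_mul _))))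
      (hind.comp hfm hgm)
    rw [hg1, mul_one] at hmul
    rw [← lintegral_indicator (hAm i), ← lintegral_congr hfg]
    refine le_trans ?_ hmul.ge
    rw [← lintegral_indicator_one (hAm i)]
    refine lintegral_mono fun ω => ?_
    by_cases hω : ω ∈ A i
    · rw [Set.indicator_of_mem hω]
      simp only [hf]
      rw [Set.indicator_of_mem ((hmem ω).2 hω)]
      simp only [Pi.one_apply, Fin.val_last]
      rw [← ENNReal.ofReal_one]
      refine ENNReal.ofReal_le_ofReal (Real.one_le_exp ?_)
      have h1 : θ * (((N:ℝ) - i)⁻¹ * W i ω) + -(2 * a ^ 2 / (σ ^ 2 * ((N:ℝ) - i)))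
        = 2 * a / (σ ^ 2 * ((N:ℝ) - i)) * (W i ω - a) := by
        rw [hθ]; field_simp; ring
      rw [h1]
      have := hω.1
      have h2 : 0 ≤ W i ω - a := by linarith
      positivity
    · rw [Set.indicator_of_notMem hω]; exact zero_le
  have hsub : {ω | ∃ i, i < N ∧ a < W i ω} ⊆ ⋃ i ∈ Finset.range N, A i := by
    classical
    rintro ω ⟨i, hi, hai⟩
    have hex : ∃ i, a < W i ω := ⟨i, hai⟩
    simp only [Set.mem_iUnion]
    refine ⟨Nat.find hex, Finset.mem_range.2 (lt_of_le_of_lt (Nat.find_min' hex hai) hi),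
      Nat.find_spec hex, fun j hj => not_lt.1 (Nat.find_min hex hj)⟩
  have hpd : Set.PairwiseDisjoint (↑(Finset.range N)) A := by
    intro i _ j _ hij
    rcases lt_or_gt_of_ne hij with h | h
    · exact hAd i j h
    · exact (hAd j i h).symm
  calc P {ω | ∃ i, i < N ∧ a < W i ω} ≤ P (⋃ i ∈ Finset.range N, A i) := measure_mono hsub
    _ ≤ ∑ i ∈ Finset.range N, P (A i) := measure_biUnion_finset_le _ _
    _ ≤ ∑ i ∈ Finset.range N, ∫⁻ ω in A i, G ω ∂P := Finset.sum_le_sum key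
    _ = ∫⁻ ω in ⋃ i ∈ Finset.range N, A i, G ω ∂P :=
        (lintegral_biUnion_finset hpd (fun i _ => hAm i) _).symm
    _ ≤ ∫⁻ ω, G ω ∂P := setLIntegral_le_lintegral _ _
    _ = _ := by
      rw [hGdef, gauss_lintegral_exp (hGe (N-1) (by omega)) (h0 _ (by omega)),
        hc _ _ le_rfl (by omega), Nat.cast_sub (by omega)]
      congr 2
      rw [hθ]; push_cast; field_simp; ring

lemma sum_ind (N i : ℕ) (hi : i ≤ N) : ∑ k : Fin N, (if (k:ℕ) < i then (1:ℝ) else 0) = i := by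
  rw [Fin.sum_univ_eq_sum_range (fun k => if k < i then (1:ℝ) else 0) N, ← Finset.sum_filter]
  have : (Finset.range N).filter (fun k => k < i) = Finset.range i := by
    ext k; simp; omega
  rw [this]; simp

lemma bridge_pi_one_sided (N : ℕ) (hN : 2 ≤ N) (σ μ : ℝ) (hσ : 0 < σ) (v : NNReal) (hv : (v:ℝ) = σ ^ 2) (s : ℝ) (hs : s ^ 2 = 1)
    (a : ℝ) (ha : 0 < a) :
    (Measure.pi fun _ : Fin N => gaussianReal μ v)
      {ω : Fin N → ℝ | ∃ i, i < N ∧ a < s *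
          ∑ k : Fin N, if (k : ℕ) < i then ω k - (∑ m, ω m) / (N : ℝ) else 0}
      ≤ ENNReal.ofReal (Real.exp (- 2 * a ^ 2 / (σ ^ 2 * N))) := by
  have hN0 : (0:ℝ) < N := by positivity
  set P := (Measure.pi fun _ : Fin N => gaussianReal μ v) with hP
  set c : ℕ → Fin N → ℝ := fun i k => s * ((if (k:ℕ) < i then 1 else 0) - i / N) with hcdef
  set W : ℕ → (Fin N → ℝ) → ℝ := fun i ω => ∑ k, c i k * ω k with hW
  have hind : iIndepFun (fun (k : Fin N) (ω : Fin N → ℝ) => ω k) P :=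
    iIndepFun_pi (μ := fun _ : Fin N => gaussianReal μ v)
      (X := fun _ x => x) (fun _ => aemeasurable_id)
  have hmap : ∀ k : Fin N, P.map (fun ω => ω k) = gaussianReal μ v := fun k =>
    (measurePreserving_eval (fun _ : Fin N => gaussianReal μ v) k).map_eq
  have hg : ∀ k : Fin N, HasGaussianLaw (fun ω : Fin N → ℝ => ω k) P := fun k =>
    ⟨by rw [hmap k]; infer_instance⟩
  have hid : HasGaussianLaw (fun ω : Fin N → ℝ => (fun k => ω k)) P := hind.hasGaussianLaw hg
  have hmean : ∀ k : Fin N, ∫ ω, ω k ∂P = μ := by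
    intro k
    have h := integral_map (μ := P) (φ := fun ω : Fin N → ℝ => ω k) (f := fun x : ℝ => x)
      (hg k |>.aemeasurable) (by fun_prop)
    rw [← h, hmap k, integral_id_gaussianReal]
  have hcov : ∀ k m : Fin N, cov[fun ω : Fin N → ℝ => ω k, fun ω => ω m; P]
      = if k = m then σ ^ 2 else 0 := by
    intro k m
    split_ifs with h
    · subst h
      rw [covariance_self (hg k |>.aemeasurable)]
      have h := variance_map (μ := P) (Y := fun ω : Fin N → ℝ => ω k) (X := fun x : ℝ => x)
        (by fun_prop) (hg k |>.aemeasurable)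
      rw [hmap k, variance_fun_id_gaussianReal] at h
      exact h.symm.trans hv
    · exact (hind.indepFun h).covariance_eq_zero (hg k).memLp_two (hg m).memLp_two
  have hcsum : ∀ i ≤ N, ∑ k, c i k = 0 := by
    intro i hi
    simp only [hcdef]
    rw [← Finset.mul_sum, Finset.sum_sub_distrib, sum_ind N i hi]
    simp
    right
    field_simp; ring
  have hcc : ∀ i j, i ≤ j → j < N → ∑ k, c i k * c j k = i * (N - j) / N := by
    intro i j hij hj
    have : ∀ k : Fin N, c i k * c j k = (if (k:ℕ) < i then (1:ℝ) else 0) * (1 - j / N)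
        - (if (k:ℕ) < j then (1:ℝ) else 0) * (i / N) + (i / N) * (j / N) := by
      intro k
      have : c i k * c j k = s ^ 2 * (((if (k:ℕ) < i then 1 else 0) - i / N)
        * ((if (k:ℕ) < j then 1 else 0) - j / N)) := by simp only [hcdef]; ring
      rw [this, hs]
      by_cases h1 : (k:ℕ) < i
      · have h2 : (k:ℕ) < j := by omega
        simp only [h1, h2, if_true]; ring
      · simp only [h1, if_false]; ring
    simp_rw [this]
    rw [Finset.sum_add_distrib, Finset.sum_sub_distrib, ← Finset.sum_mul, ← Finset.sum_mul,
      sum_ind N i (by omega), sum_ind N j (by omega)]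
    simp
    field_simp; ring
  have hmem : ∀ i (k : Fin N), MemLp (fun ω : Fin N → ℝ => c i k * ω k) 2 P := fun i k =>
    (hg k).memLp_two.const_mul _
  have := bridge_one_sided N hN σ hσ W (P := P) (fun i => by fun_prop)
    (hid.map_fun (ContinuousLinearMap.pi fun i : Fin N => ∑ k : Fin N, c i k •
      ContinuousLinearMap.proj (R := ℝ) (φ := fun _ : Fin N => ℝ) k) |>.congr
      (Filter.Eventually.of_forall fun ω => by ext i; simp [hW])) ?_ ?_ a ha
  · refine le_trans (measure_mono ?_) this
    rintro ω ⟨i, hi, h⟩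
    refine ⟨i, hi, lt_of_lt_of_eq h ?_⟩
    have e : ∀ k : Fin N, (if (k : ℕ) < i then ω k - (∑ m, ω m) / (N : ℝ) else 0)
      = (if (k:ℕ) < i then (1:ℝ) else 0) * ω k
        - (if (k:ℕ) < i then (1:ℝ) else 0) * ((∑ m, ω m) / N) := by
      intro k; split_ifs <;> ring
    have e2 : ∀ k : Fin N, c i k * ω k = s * ((if (k:ℕ) < i then (1:ℝ) else 0) * ω k)
        - s * (i / N) * ω k := by
      intro k; simp only [hcdef]; ring
    simp only [hW]
    simp_rw [e, e2]
    rw [Finset.sum_sub_distrib, Finset.sum_sub_distrib, ← Finset.sum_mul, sum_ind N i hi.le,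
      ← Finset.mul_sum, ← Finset.mul_sum]
    ring
  · intro i hi
    simp only [hW]
    rw [integral_finsetSum _ fun k _ => (hg k).integrable.const_mul _]
    simp_rw [integral_const_mul, hmean]
    rw [← Finset.sum_mul, hcsum i hi.le, zero_mul]
  · intro i j hij hj
    simp only [hW]
    rw [covariance_fun_sum_fun_sum (hmem i) (hmem j)]
    simp_rw [covariance_const_mul_left, covariance_const_mul_right, hcov]
    simp only [mul_ite, mul_zero, Finset.sum_ite_eq, Finset.mem_univ, if_true]
    have e : ∀ k, c i k * (c j k * σ ^ 2) = (c i k * c j k) * σ ^ 2 := fun k => by ring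
    simp_rw [e]
    rw [← Finset.sum_mul, hcc i j hij hj]
    ring



lemma bridge_two_sided
    (N : ℕ) (hN : 2 ≤ N) (σ μ : ℝ) (hσ : 0 < σ) (u : ℝ) (hu : 0 < u) (v : NNReal) (hv : (v:ℝ) = σ ^ 2) :
    ENNReal.ofReal (1 - 2 * Real.exp (-2 * u ^ 2)) ≤
      (Measure.pi fun _ : Fin N => gaussianReal μ v)
        {ω : Fin N → ℝ | ∀ i : ℕ, 1 ≤ i → i ≤ N - 1 →
          |∑ k : Fin N, if (k : ℕ) < i then ω k - (∑ m, ω m) / (N : ℝ) else 0| ≤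
            σ * Real.sqrt N * u} := by
  have hN0 : (0:ℝ) < N := by positivity
  set P := (Measure.pi fun _ : Fin N => gaussianReal μ v) with hP
  have ha : 0 < σ * Real.sqrt N * u := by positivity
  have h1 := bridge_pi_one_sided N hN σ μ hσ v hv 1 (by norm_num) _ ha
  have h2 := bridge_pi_one_sided N hN σ μ hσ v hv (-1) (by norm_num) _ ha
  rw [← hP] at h1 h2
  have he : -2 * (σ * Real.sqrt N * u) ^ 2 / (σ ^ 2 * N) = -2 * u ^ 2 := by
    rw [mul_pow, mul_pow, Real.sq_sqrt hN0.le]; field_simp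
  rw [he] at h1 h2
  set S := {ω : Fin N → ℝ | ∀ i : ℕ, 1 ≤ i → i ≤ N - 1 →
          |∑ k : Fin N, if (k : ℕ) < i then ω k - (∑ m, ω m) / (N : ℝ) else 0| ≤
            σ * Real.sqrt N * u} with hS
  have hc : P Sᶜ ≤ ENNReal.ofReal (2 * Real.exp (-2 * u ^ 2)) := by
    rw [two_mul, ENNReal.ofReal_add (Real.exp_pos _).le (Real.exp_pos _).le]
    refine le_trans (le_trans (measure_mono ?_) (measure_union_le _ _)) (add_le_add h1 h2)
    intro ω hω
    have hω' : ¬ ∀ i : ℕ, 1 ≤ i → i ≤ N - 1 →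
          |∑ k : Fin N, if (k : ℕ) < i then ω k - (∑ m, ω m) / (N : ℝ) else 0| ≤
            σ * Real.sqrt N * u := hω
    push Not at hω'
    obtain ⟨i, hi1, hi2, h⟩ := hω'
    rcases lt_abs.1 h with h | h
    · exact Or.inl ⟨i, by omega, by rwa [one_mul]⟩
    · exact Or.inr ⟨i, by omega, by rwa [neg_one_mul]⟩
  rw [ENNReal.ofReal_sub _ (by positivity), ENNReal.ofReal_one]
  refine tsub_le_iff_right.2 ?_
  calc (1 : ENNReal) = P Set.univ := measure_univ.symm
    _ = P (S ∪ Sᶜ) := by rw [Set.union_compl_self]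
    _ ≤ P S + P Sᶜ := measure_union_le _ _
    _ ≤ _ := by gcongr


/-- for `Y₁,…,Y_N` i.i.d. `N(μ,σ²)` with sample mean `Ȳ` and discrete bridge
`Wᵢ = Σ_{k=1}^i (Y_k − Ȳ)` (`i = 1,…,N−1`), for every `u > 0`,
`ℙ(max_{1≤i≤N−1} |Wᵢ| ≤ σ√N·u) ≥ 1 − 2·exp(−2u²)`. -/
theorem discrete_bridge_sup_tail_bound
    (N : ℕ) (hN : 2 ≤ N) (σ μ : ℝ) (hσ : 0 < σ) (u : ℝ) (hu : 0 < u) :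
    ENNReal.ofReal (1 - 2 * Real.exp (-2 * u ^ 2)) ≤
      (Measure.pi fun _ : Fin N => gaussianReal μ ⟨σ ^ 2, sq_nonneg σ⟩)
        {ω : Fin N → ℝ | ∀ i : ℕ, 1 ≤ i → i ≤ N - 1 →
          |∑ k : Fin N, if (k : ℕ) < i then ω k - (∑ m, ω m) / (N : ℝ) else 0| ≤
            σ * Real.sqrt N * u} := by
  exact bridge_two_sided N hN σ μ hσ u hu ⟨σ ^ 2, sq_nonneg σ⟩ rfl
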